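/- Let X ⊂ S^{m-1} be an antipodal s-distance set with strength 2s-2i-1, where 1+δ_s ≤ i ≤ s+δ_s and δ_s = 1 if s is odd, 0 if s is even. Then |X| ≤ 2∑_{k=0}^{(s-δ_s)/2} h_{2k} − 2 h_{s+δ_s-2i}. -/

import Mathlib

open Polynomial Finset
open scoped RealInnerProductSpace Classical

/-- `lamG m k = k / (m + 2k - 2)`, the coefficients in the Gegenbauer recurrence. -/
noncomputable def lamG (m k : ℕ) : ℝ := (k : ℝ) / ((m : ℝ) + 2 * k - 2)

/-- The Gegenbauer polynomials for `S^{m-1}`, normalized so that `geg m k` has value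
`dim Harm_k(ℝ^m)` at `1`: `G_0 = 1`, `G_1 = m X`, and
`X * G_k = lamG (k+1) • G_{k+1} + (1 - lamG (k-1)) • G_{k-1}`. -/
noncomputable def geg (m : ℕ) : ℕ → Polynomial ℝ
  | 0 => 1
  | 1 => Polynomial.C (m : ℝ) * Polynomial.X
  | (k + 2) => (lamG m (k + 2))⁻¹ •
      (Polynomial.X * geg m (k + 1) - (1 - lamG m k) • geg m k)

/-- The set of inner products between distinct points of `X`. -/
noncomputable def innerSet (m : ℕ) (X : Finset (EuclideanSpace ℝ (Fin m))) : Finset ℝ :=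
  ((X ×ˢ X).filter fun p => p.1 ≠ p.2).image fun p => ⟪p.1, p.2⟫

/-- `X` is a spherical `t`-design iff `∑_{x,y ∈ X} G_i(⟨x,y⟩) = 0` for `1 ≤ i ≤ t`. -/
noncomputable def IsGegDesign (m t : ℕ) (X : Finset (EuclideanSpace ℝ (Fin m))) : Prop :=
  ∀ i : ℕ, 1 ≤ i → i ≤ t → ∑ x ∈ X, ∑ y ∈ X, (geg m i).eval ⟪x, y⟫ = 0

/-- `hdim m k = dim Harm_k(ℝ^m) = C(m+k-1, k) - C(m+k-3, k-2)`. -/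
def hdim (m k : ℕ) : ℕ :=
  (m + k - 1).choose k - if 2 ≤ k then (m + k - 3).choose (k - 2) else 0

/-- `X` is a spherical `t`-design for an integer `t` (vacuous for `t ≤ 0`). -/
noncomputable def IsGegDesignZ (m : ℕ) (t : ℤ) (X : Finset (EuclideanSpace ℝ (Fin m))) : Prop :=
  ∀ i : ℤ, 1 ≤ i → i ≤ t → ∑ x ∈ X, ∑ y ∈ X, (geg m i.toNat).eval ⟪x, y⟫ = 0

/-- `hdim` extended to integer indices, zero for negative indices. -/
def hdimZ (m : ℕ) (k : ℤ) : ℕ := if k < 0 then 0 else hdim m k.toNat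


section Fischer

variable {m : ℕ}

/-- The Fischer form on polynomials. -/
noncomputable def fischer (m : ℕ) :
    MvPolynomial (Fin m) ℝ →ₗ[ℝ] MvPolynomial (Fin m) ℝ →ₗ[ℝ] ℝ :=
  (MvPolynomial.basisMonomials (Fin m) ℝ).constr ℝ
    (fun α => ((∏ i, (α i).factorial : ℕ) : ℝ) • MvPolynomial.lcoeff ℝ α)

theorem fischer_monomial (α : Fin m →₀ ℕ) (c : ℝ) (q : MvPolynomial (Fin m) ℝ) :
    fischer m (MvPolynomial.monomial α c) q
      = c * (((∏ i, (α i).factorial : ℕ) : ℝ) * MvPolynomial.coeff α q) := by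
  have h : MvPolynomial.monomial α c = c • (MvPolynomial.basisMonomials (Fin m) ℝ) α := by
    simp [MvPolynomial.smul_monomial]
  rw [h, map_smul, fischer, Module.Basis.constr_basis]
  simp [MvPolynomial.lcoeff]

theorem fischer_apply (p q : MvPolynomial (Fin m) ℝ) :
    fischer m p q = ∑ α ∈ p.support,
      ((∏ i, (α i).factorial : ℕ) : ℝ) * (MvPolynomial.coeff α p * MvPolynomial.coeff α q) := by
  conv_lhs => rw [MvPolynomial.as_sum p]
  rw [map_sum, LinearMap.sum_apply]
  refine Finset.sum_congr rfl fun α _ => ?_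
  rw [fischer_monomial]; ring

theorem fischer_symm (p q : MvPolynomial (Fin m) ℝ) : fischer m p q = fischer m q p := by
  have h : ∀ p q : MvPolynomial (Fin m) ℝ, fischer m p q = ∑ α ∈ p.support ∪ q.support,
      ((∏ i, (α i).factorial : ℕ) : ℝ) * (MvPolynomial.coeff α p * MvPolynomial.coeff α q) := by
    intro p q
    rw [fischer_apply]
    refine Finset.sum_subset Finset.subset_union_left ?_
    intro α _ h
    rw [MvPolynomial.notMem_support_iff] at h
    simp [h]
  rw [h, h, Finset.union_comm]
  refine Finset.sum_congr rfl fun α _ => ?_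
  ring

theorem fischer_self_pos (p : MvPolynomial (Fin m) ℝ) (hp : p ≠ 0) : 0 < fischer m p p := by
  rw [fischer_apply]
  refine Finset.sum_pos ?_ (by simpa [Finset.nonempty_iff_ne_empty] using hp)
  intro α hα
  rw [MvPolynomial.mem_support_iff] at hα
  have : 0 < MvPolynomial.coeff α p * MvPolynomial.coeff α p := mul_self_pos.mpr hα
  have h2 : (0:ℝ) < ((∏ i, (α i).factorial : ℕ) : ℝ) := by
    exact_mod_cast Finset.prod_pos fun i _ => Nat.factorial_pos _
  positivity

theorem fischer_X_mul (i : Fin m) (p q : MvPolynomial (Fin m) ℝ) :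
    fischer m (MvPolynomial.X i * p) q = fischer m p (MvPolynomial.pderiv i q) := by
  induction p using MvPolynomial.induction_on' with
  | monomial α c =>
    rw [fischer_monomial, MvPolynomial.X, MvPolynomial.monomial_mul, one_mul, fischer_monomial,
      MvPolynomial.coeff_pderiv, add_comm (Finsupp.single i 1) α]
    have h : (∏ j, ((α + Finsupp.single i 1 : Fin m →₀ ℕ) j).factorial)
        = (α i + 1) * ∏ j, (α j).factorial := by
      rw [← Finset.mul_prod_erase _ _ (Finset.mem_univ i),
        ← Finset.mul_prod_erase _ _ (Finset.mem_univ i)]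
      have : ∏ x ∈ Finset.univ.erase i, ((α + Finsupp.single i 1 : Fin m →₀ ℕ) x).factorial
          = ∏ x ∈ Finset.univ.erase i, (α x).factorial := by
        refine Finset.prod_congr rfl fun x hx => ?_
        have : x ≠ i := (Finset.mem_erase.mp hx).1
        simp [this]
      rw [this]
      simp [Nat.factorial_succ, mul_assoc]
    rw [h]
    push_cast
    ring
  | add p q hp hq => simp [mul_add, hp, hq]

/-- The linear form `⟨x, y⟩` in the variable `x`. -/
noncomputable def linf (y : Fin m → ℝ) : MvPolynomial (Fin m) ℝ :=
  ∑ i, MvPolynomial.C (y i) * MvPolynomial.X i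

/-- The squared norm polynomial. -/
noncomputable def nsq (m : ℕ) : MvPolynomial (Fin m) ℝ := ∑ i, MvPolynomial.X i * MvPolynomial.X i

/-- The directional derivative. -/
noncomputable def dird (y : Fin m → ℝ) :
    Derivation ℝ (MvPolynomial (Fin m) ℝ) (MvPolynomial (Fin m) ℝ) :=
  ∑ i, (y i) • MvPolynomial.pderiv i

/-- The Laplacian. -/
noncomputable def lapl (m : ℕ) : MvPolynomial (Fin m) ℝ →ₗ[ℝ] MvPolynomial (Fin m) ℝ :=
  ∑ i, (MvPolynomial.pderiv i).toLinearMap ∘ₗ (MvPolynomial.pderiv i).toLinearMap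

theorem lapl_apply (p : MvPolynomial (Fin m) ℝ) :
    lapl m p = ∑ i, MvPolynomial.pderiv i (MvPolynomial.pderiv i p) := by
  simp [lapl]

theorem dird_apply (y : Fin m → ℝ) (p : MvPolynomial (Fin m) ℝ) :
    dird y p = ∑ i, y i • MvPolynomial.pderiv i p := by
  simp only [dird]
  rw [← Derivation.coeFnAddMonoidHom_apply, map_sum, Finset.sum_apply]
  rfl

theorem fischer_linf_mul (y : Fin m → ℝ) (p q : MvPolynomial (Fin m) ℝ) :
    fischer m (linf y * p) q = fischer m p (dird y q) := by
  rw [dird_apply, linf, Finset.sum_mul, map_sum, map_sum, LinearMap.sum_apply]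
  refine Finset.sum_congr rfl fun i _ => ?_
  rw [mul_assoc, ← MvPolynomial.smul_eq_C_mul, map_smul, map_smul, LinearMap.smul_apply,
    fischer_X_mul]

theorem fischer_nsq_mul (p q : MvPolynomial (Fin m) ℝ) :
    fischer m (nsq m * p) q = fischer m p (lapl m q) := by
  rw [lapl_apply, nsq, Finset.sum_mul, map_sum, map_sum, LinearMap.sum_apply]
  refine Finset.sum_congr rfl fun i _ => ?_
  rw [mul_assoc, fischer_X_mul, fischer_X_mul]

theorem fischer_linf_pow (y : Fin m → ℝ) (k : ℕ) (q : MvPolynomial (Fin m) ℝ)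
    (hq : q.IsHomogeneous k) :
    fischer m (linf y ^ k) q = (k.factorial : ℝ) * MvPolynomial.eval y q := by
  induction k generalizing q with
  | zero =>
    have h1 : (linf y ^ 0 : MvPolynomial (Fin m) ℝ) = MvPolynomial.monomial 0 1 := by simp
    have h2 : q = MvPolynomial.C (MvPolynomial.coeff 0 q) := by
      rw [← MvPolynomial.totalDegree_zero_iff_isHomogeneous] at hq
      exact MvPolynomial.totalDegree_eq_zero_iff_eq_C.mp hq
    rw [h1, fischer_monomial]
    conv_rhs => rw [h2]
    simp
  | succ k ih =>
    have hd : (dird y q).IsHomogeneous k := by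
      rw [dird_apply]
      refine MvPolynomial.IsHomogeneous.sum _ _ _ fun i _ => ?_
      rw [MvPolynomial.smul_eq_C_mul]
      exact MvPolynomial.IsHomogeneous.C_mul (by simpa using hq.pderiv (i := i)) _
    rw [pow_succ', fischer_linf_mul, ih _ hd]
    have he := congrArg (MvPolynomial.eval y) hq.sum_X_mul_pderiv
    have : MvPolynomial.eval y (dird y q) = (k + 1 : ℝ) * MvPolynomial.eval y q := by
      rw [dird_apply]
      simp only [map_sum, map_mul, MvPolynomial.eval_X, MvPolynomial.smul_eval, map_nsmul] at he ⊢
      rw [he]; simp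
    rw [this, Nat.factorial_succ]
    push_cast
    ring

theorem linf_homog (y : Fin m → ℝ) : (linf y).IsHomogeneous 1 :=
  MvPolynomial.IsHomogeneous.sum _ _ _ fun _ _ => MvPolynomial.isHomogeneous_C_mul_X _ _

theorem nsq_homog : (nsq m).IsHomogeneous 2 :=
  MvPolynomial.IsHomogeneous.sum _ _ _ fun i _ =>
    (MvPolynomial.isHomogeneous_X _ i).mul (MvPolynomial.isHomogeneous_X _ i)

theorem finrank_homog (m k : ℕ) :
    Module.finrank ℝ (MvPolynomial.homogeneousSubmodule (Fin m) ℝ k) = (m + k - 1).choose k := by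
  let b : {d : Fin m →₀ ℕ // d.sum (fun _ ↦ id) = k} → MvPolynomial (Fin m) ℝ :=
    fun d => MvPolynomial.basisMonomials (Fin m) ℝ d.1
  have hli : LinearIndependent ℝ b :=
    (MvPolynomial.basisMonomials (Fin m) ℝ).linearIndependent.comp _ Subtype.val_injective
  have hs : MvPolynomial.homogeneousSubmodule (Fin m) ℝ k = Submodule.span ℝ (Set.range b) := by
    apply le_antisymm
    · intro p hp
      rw [MvPolynomial.as_sum p]
      refine Submodule.sum_mem _ fun α hα => ?_
      have h : MvPolynomial.monomial α (MvPolynomial.coeff α p)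
        = (MvPolynomial.coeff α p) • (MvPolynomial.basisMonomials (Fin m) ℝ) α := by
        simp [MvPolynomial.smul_monomial]
      rw [h]
      refine Submodule.smul_mem _ _ (Submodule.subset_span ⟨⟨α, ?_⟩, rfl⟩)
      have := hp (MvPolynomial.mem_support_iff.mp hα)
      rw [← this]
      simp [Finsupp.weight_apply]
      rfl
    · rw [Submodule.span_le]
      rintro _ ⟨d, rfl⟩
      simp only [b, MvPolynomial.coe_basisMonomials]
      refine MvPolynomial.isHomogeneous_monomial _ ?_
      exact d.2
  let _ : Fintype {d : Fin m →₀ ℕ // d.sum (fun _ ↦ id) = k} :=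
    Fintype.ofEquiv _ (Sym.equivNatSum (Fin m) k)
  rw [hs, finrank_span_eq_card hli, ← Fintype.card_congr (Sym.equivNatSum (Fin m) k),
    Sym.card_sym_eq_choose, Fintype.card_fin]

/-- Harmonic homogeneous polynomials. -/
noncomputable def harm (m k : ℕ) : Submodule ℝ (MvPolynomial (Fin m) ℝ) :=
  MvPolynomial.homogeneousSubmodule (Fin m) ℝ k ⊓ LinearMap.ker (lapl m)

instance homog_fin (m k : ℕ) :
    FiniteDimensional ℝ (MvPolynomial.homogeneousSubmodule (Fin m) ℝ k) :=
  Module.Finite.iff_fg.mpr (MvPolynomial.homogeneousSubmodule_fg _ _ k)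

instance harm_fin (m k : ℕ) : FiniteDimensional ℝ (harm m k) :=
  Submodule.finiteDimensional_inf_left _ _

theorem nsq_ne_zero (hm : 1 ≤ m) : nsq m ≠ 0 := by
  intro h
  have := congrArg (MvPolynomial.eval (fun _ => (1:ℝ))) h
  simp [nsq] at this
  omega

theorem finrank_harm_le (m k : ℕ) (hm : 1 ≤ m) : Module.finrank ℝ (harm m k) ≤ hdim m k := by
  have h1 : Module.finrank ℝ (harm m k) ≤ (m + k - 1).choose k := by
    rw [← finrank_homog]
    exact Submodule.finrank_mono inf_le_left
  unfold hdim
  split_ifs with hk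
  · let μ : MvPolynomial (Fin m) ℝ →ₗ[ℝ] MvPolynomial (Fin m) ℝ := LinearMap.mulLeft ℝ (nsq m)
    have hinj : Function.Injective μ := fun p q h => mul_left_cancel₀ (nsq_ne_zero hm) h
    let W := (MvPolynomial.homogeneousSubmodule (Fin m) ℝ (k - 2)).map μ
    have hW : Module.finrank ℝ W = (m + k - 3).choose (k - 2) := by
      rw [← (Submodule.equivMapOfInjective μ hinj _).finrank_eq, finrank_homog]
      congr 1; omega
    have hle : harm m k ⊔ W ≤ MvPolynomial.homogeneousSubmodule (Fin m) ℝ k := by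
      refine sup_le inf_le_left ?_
      rintro _ ⟨p, hp, rfl⟩
      have : (nsq m * p).IsHomogeneous (2 + (k - 2)) := nsq_homog.mul hp
      rwa [show 2 + (k - 2) = k by omega] at this
    have hdis : harm m k ⊓ W = ⊥ := by
      rw [eq_bot_iff]
      rintro p ⟨hp, q, hq, rfl⟩
      by_contra hne
      have := fischer_self_pos _ hne
      have h0 : lapl m (nsq m * q) = 0 := hp.2
      change 0 < fischer m (nsq m * q) (nsq m * q) at this
      rw [fischer_nsq_mul, h0] at this
      simp at this
    have := Submodule.finrank_sup_add_finrank_inf_eq (harm m k) W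
    rw [hdis, finrank_bot, hW] at this
    have h2 := Submodule.finrank_mono hle
    rw [finrank_homog] at h2
    omega
  · simpa using h1

end Fischer

section Zonal

variable {m : ℕ}

theorem lamG_pos (hm : 2 ≤ m) (k : ℕ) (hk : 1 ≤ k) : 0 < lamG m k := by
  have h1 : (2:ℝ) ≤ m := by exact_mod_cast hm
  have h2 : (1:ℝ) ≤ k := by exact_mod_cast hk
  unfold lamG
  apply div_pos <;> linarith

theorem lamG_zero : lamG m 0 = 0 := by simp [lamG]

/-- The zonal polynomials. -/
noncomputable def zon (y : Fin m → ℝ) : ℕ → MvPolynomial (Fin m) ℝ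
  | 0 => 1
  | 1 => MvPolynomial.C (m : ℝ) * linf y
  | (k + 2) => MvPolynomial.C (lamG m (k + 2))⁻¹ *
      (linf y * zon y (k + 1) - MvPolynomial.C (1 - lamG m k) * (nsq m * zon y k))

theorem zon_rec (hm : 2 ≤ m) (y : Fin m → ℝ) (k : ℕ) :
    MvPolynomial.C (lamG m (k + 2)) * zon y (k + 2) =
      linf y * zon y (k + 1) - MvPolynomial.C (1 - lamG m k) * (nsq m * zon y k) := by
  rw [zon, ← mul_assoc, ← MvPolynomial.C_mul,
    mul_inv_cancel₀ (lamG_pos hm (k + 2) (by omega)).ne', MvPolynomial.C_1, one_mul]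

theorem zon_homog (y : Fin m → ℝ) (k : ℕ) : (zon y k).IsHomogeneous k := by
  induction k using Nat.twoStepInduction with
  | zero => exact MvPolynomial.isHomogeneous_one _ _
  | one => exact (linf_homog y).C_mul _
  | more k ih1 ih2 =>
    rw [zon]
    refine MvPolynomial.IsHomogeneous.C_mul ?_ _
    refine MvPolynomial.IsHomogeneous.sub ?_ (MvPolynomial.IsHomogeneous.C_mul ?_ _)
    · have := (linf_homog y).mul ih2
      rwa [show 1 + (k + 1) = k + 2 by omega] at this
    · have := (nsq_homog (m := m)).mul ih1
      rwa [show 2 + k = k + 2 by omega] at this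

theorem zon_eval (x y : Fin m → ℝ) (hx : ∑ i, x i * x i = 1) (k : ℕ) :
    MvPolynomial.eval x (zon y k) = (geg m k).eval (∑ i, y i * x i) := by
  have h1 : MvPolynomial.eval x (linf y) = ∑ i, y i * x i := by simp [linf]
  have h2 : MvPolynomial.eval x (nsq m) = 1 := by simp [nsq, hx]
  induction k using Nat.twoStepInduction with
  | zero => simp [zon, geg]
  | one => simp [zon, geg, h1]
  | more k ih1 ih2 =>
    simp only [zon, geg, map_mul, map_sub, MvPolynomial.eval_C, h1, h2, ih1, ih2,
      Polynomial.eval_smul, Polynomial.eval_sub, Polynomial.eval_mul, Polynomial.eval_X,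
      smul_eq_mul, one_mul]

theorem pderiv_linf (y : Fin m → ℝ) (i : Fin m) :
    MvPolynomial.pderiv i (linf y) = MvPolynomial.C (y i) := by
  simp only [linf, map_sum, MvPolynomial.pderiv_C_mul]
  rw [Finset.sum_eq_single i]
  · simp
  · intro j _ hj
    simp [MvPolynomial.pderiv_X_of_ne hj]
  · simp

theorem pderiv_nsq (i : Fin m) :
    MvPolynomial.pderiv i (nsq m) = 2 * MvPolynomial.X i := by
  simp only [nsq, map_sum, MvPolynomial.pderiv_mul]
  rw [Finset.sum_eq_single i]
  · simp; ring
  · intro j _ hj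
    simp [MvPolynomial.pderiv_X_of_ne hj]
  · simp

theorem dird_linf (y : Fin m → ℝ) (hy : ∑ i, y i * y i = 1) : dird y (linf y) = 1 := by
  rw [dird_apply]
  simp only [pderiv_linf, MvPolynomial.smul_eq_C_mul, ← MvPolynomial.C_mul]
  rw [← map_sum, hy, MvPolynomial.C_1]

theorem dird_nsq (y : Fin m → ℝ) : dird y (nsq m) = 2 * linf y := by
  rw [dird_apply]
  simp only [pderiv_nsq, MvPolynomial.smul_eq_C_mul, linf, Finset.mul_sum]
  refine Finset.sum_congr rfl fun i _ => ?_
  ring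

theorem lapl_linf_mul (y : Fin m → ℝ) (p : MvPolynomial (Fin m) ℝ) :
    lapl m (linf y * p) = 2 * dird y p + linf y * lapl m p := by
  simp only [lapl_apply, dird_apply, MvPolynomial.pderiv_mul, pderiv_linf, map_add,
    MvPolynomial.pderiv_C, MvPolynomial.smul_eq_C_mul, Finset.mul_sum]
  rw [← Finset.sum_add_distrib]
  refine Finset.sum_congr rfl fun i _ => ?_
  ring

theorem lapl_nsq_mul (p : MvPolynomial (Fin m) ℝ) (k : ℕ) (hp : p.IsHomogeneous k) :
    lapl m (nsq m * p) = MvPolynomial.C (2 * (m : ℝ) + 4 * k) * p + nsq m * lapl m p := by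
  have he := hp.sum_X_mul_pderiv
  have h2 : ∀ i : Fin m, MvPolynomial.pderiv i (2 : MvPolynomial (Fin m) ℝ) = 0 := by
    intro i
    have : (2 : MvPolynomial (Fin m) ℝ) = MvPolynomial.C 2 := (map_ofNat MvPolynomial.C 2).symm
    rw [this, MvPolynomial.pderiv_C]
  have : lapl m (nsq m * p) = ∑ i : Fin m, (2 * p
      + 4 * (MvPolynomial.X i * MvPolynomial.pderiv i p)
      + nsq m * MvPolynomial.pderiv i (MvPolynomial.pderiv i p)) := by
    simp only [lapl_apply, MvPolynomial.pderiv_mul, pderiv_nsq, map_add,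
      MvPolynomial.pderiv_X_self, h2]
    refine Finset.sum_congr rfl fun i _ => ?_
    ring
  rw [this, Finset.sum_add_distrib, Finset.sum_add_distrib, ← Finset.mul_sum,
    ← Finset.mul_sum, ← Finset.mul_sum, he, ← lapl_apply]
  simp [map_ofNat MvPolynomial.C]
  ring

theorem dird_zon (hm : 2 ≤ m) (y : Fin m → ℝ) (hy : ∑ i, y i * y i = 1) (k : ℕ) :
    dird y (zon y (k + 1)) = MvPolynomial.C ((1 - lamG m k) * (m + 2 * k)) * zon y k := by
  have hm' : (2:ℝ) ≤ m := by exact_mod_cast hm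
  have hC : ∀ (a : ℝ) p, dird y (MvPolynomial.C a * p) = MvPolynomial.C a * dird y p := by
    intro a p
    rw [← MvPolynomial.smul_eq_C_mul, ← MvPolynomial.smul_eq_C_mul, Derivation.map_smul]
  have hD : ∀ k, MvPolynomial.C (lamG m (k + 2)) * dird y (zon y (k + 2)) =
      zon y (k + 1) + linf y * dird y (zon y (k + 1))
       - MvPolynomial.C (1 - lamG m k) * (2 * linf y * zon y k + nsq m * dird y (zon y k)) := by
    intro k
    rw [← hC, zon_rec hm, map_sub, hC, Derivation.leibniz, Derivation.leibniz, dird_linf y hy,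
      dird_nsq]
    simp only [smul_eq_mul]
    ring
  induction k using Nat.twoStepInduction with
  | zero => simp [zon, dird_linf y hy, lamG_zero]
  | one =>
    have hc : MvPolynomial.C (σ := Fin m) (lamG m 2) ≠ 0 := by
      simpa using (lamG_pos hm 2 (by omega)).ne'
    apply mul_left_cancel₀ hc
    rw [hD 0]
    have h0 : dird y (zon y 0) = 0 := by simp [zon]
    rw [h0]
    simp only [zon, hC, dird_linf y hy, lamG_zero]
    have : 2 * (m:ℝ) - 2 = lamG m 2 * ((1 - lamG m 1) * (m + 2 * (1:ℕ)) * m) := by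
      unfold lamG
      have : (m:ℝ) ≠ 0 := by linarith
      have : (m:ℝ) + 2 ≠ 0 := by linarith
      push_cast
      rw [show (m:ℝ) + 2 * 2 - 2 = m + 2 by ring, show (m:ℝ) + 2 * 1 - 2 = m by ring]
      field_simp
    have h := congrArg (MvPolynomial.C (σ := Fin m)) this
    simp only [map_zero, map_mul, map_sub, map_add, map_one, map_ofNat, map_natCast] at h ⊢
    linear_combination linf y * h
  | more k ih1 ih2 =>
    have hc : MvPolynomial.C (σ := Fin m) (lamG m (k + 3)) ≠ 0 := by
      simpa using (lamG_pos hm (k + 3) (by omega)).ne'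
    apply mul_left_cancel₀ hc
    have h1 := hD (k + 1)
    rw [show k + 1 + 2 = k + 3 by omega, show k + 1 + 1 = k + 2 by omega] at h1
    rw [show k + 2 + 1 = k + 3 by omega, h1]
    rw [show k + 1 + 1 = k + 2 by omega] at ih2
    rw [ih1, ih2]
    have hr := zon_rec hm y k
    have hs : 1 + (1 - lamG m (k + 1)) * (m + 2 * k) * lamG m (k + 2)
        = lamG m (k + 3) * ((1 - lamG m (k + 2)) * (m + 2 * ((k + 2 : ℕ) : ℝ))) := by
      unfold lamG
      have hk : (0:ℝ) ≤ k := by positivity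
      have : (m:ℝ) + 2 * k ≠ 0 := by linarith
      have : (m:ℝ) + 2 * k + 2 ≠ 0 := by linarith
      have : (m:ℝ) + 2 * k + 4 ≠ 0 := by linarith
      push_cast
      rw [show (m:ℝ) + 2 * (k + 1) - 2 = m + 2 * k by ring,
        show (m:ℝ) + 2 * (k + 2) - 2 = m + 2 * k + 2 by ring,
        show (m:ℝ) + 2 * (k + 3) - 2 = m + 2 * k + 4 by ring,
        show (m:ℝ) + 2 * (k + 2) = m + 2 * k + 4 by ring]
      field_simp
      ring
    have h := congrArg (MvPolynomial.C (σ := Fin m)) hs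
    simp only [map_mul, map_sub, map_add, map_one, map_ofNat, map_natCast] at h hr ⊢
    push_cast at h ⊢
    linear_combination zon y (k + 2) * h -
      (1 - MvPolynomial.C (lamG m (k + 1))) * (m + 2 * k) * hr

theorem lapl_zon (hm : 2 ≤ m) (y : Fin m → ℝ) (hy : ∑ i, y i * y i = 1) (k : ℕ) :
    lapl m (zon y k) = 0 := by
  have hC : ∀ (a : ℝ) p, lapl m (MvPolynomial.C a * p) = MvPolynomial.C a * lapl m p := by
    intro a p
    rw [← MvPolynomial.smul_eq_C_mul, ← MvPolynomial.smul_eq_C_mul, map_smul]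
  induction k using Nat.twoStepInduction with
  | zero => simp [zon, lapl_apply]
  | one => simp [zon, lapl_apply, pderiv_linf]
  | more k ih1 ih2 =>
    rw [zon, hC, map_sub, hC, lapl_linf_mul, lapl_nsq_mul _ k (zon_homog y k), ih1, ih2,
      dird_zon hm y hy]
    simp only [map_mul, map_sub, map_add, map_one, map_ofNat, map_natCast]
    ring

theorem zon_lead (hm : 2 ≤ m) (k : ℕ) :
    ∃ g : ℝ, 0 < g ∧ ∀ y : Fin m → ℝ, ∃ (Q : MvPolynomial (Fin m) ℝ),
      zon y k = MvPolynomial.C g * linf y ^ k + nsq m * Q := by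
  have hm' : (2:ℝ) ≤ m := by exact_mod_cast hm
  induction k using Nat.twoStepInduction with
  | zero => exact ⟨1, one_pos, fun y => ⟨0, by simp [zon]⟩⟩
  | one => exact ⟨m, by linarith, fun y => ⟨0, by simp [zon]⟩⟩
  | more k ih1 ih2 =>
    obtain ⟨g, hg, h⟩ := ih2
    refine ⟨(lamG m (k + 2))⁻¹ * g, mul_pos (inv_pos.mpr (lamG_pos hm _ (by omega))) hg, ?_⟩
    intro y
    obtain ⟨Q, hQ⟩ := h y
    refine ⟨MvPolynomial.C (lamG m (k + 2))⁻¹ * (linf y * Q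
      - MvPolynomial.C (1 - lamG m k) * zon y k), ?_⟩
    rw [zon, hQ, map_mul]
    ring

theorem geg_factor (hm : 2 ≤ m) (k : ℕ) :
    ∃ (d : ℕ) (φ : EuclideanSpace ℝ (Fin m) → Fin d → ℝ), d ≤ hdim m k ∧
      ∀ x y : EuclideanSpace ℝ (Fin m), ‖x‖ = 1 → ‖y‖ = 1 →
        (geg m k).eval ⟪x, y⟫ = ∑ a, φ x a * φ y a := by
  have hsum : ∀ x : EuclideanSpace ℝ (Fin m), ‖x‖ = 1 → ∑ i, x i * x i = 1 := by
    intro x hx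
    have := real_inner_self_eq_norm_sq x
    rw [hx, PiLp.inner_apply] at this
    simpa [← pow_two] using this
  let B : LinearMap.BilinForm ℝ (harm m k) := (fischer m).domRestrict₁₂ (harm m k) (harm m k)
  have hBapp : ∀ u v : harm m k, B u v = fischer m u.1 v.1 := fun u v => rfl
  have hB : LinearMap.IsSymm B := ⟨fun u v => fischer_symm _ _⟩
  obtain ⟨b, hb⟩ := LinearMap.BilinForm.exists_orthogonal_basis hB
  obtain ⟨g, hg, hQ⟩ := zon_lead hm k
  have hpos : ∀ a, 0 < B (b a) (b a) := by
    intro a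
    apply fischer_self_pos
    simpa using b.ne_zero a
  have hgk : 0 < g * k.factorial := by positivity
  have hexp : ∀ u v, B u v = ∑ a, B u (b a) * B v (b a) / B (b a) (b a) := by
    intro u v
    have hv : ∀ v a, B v (b a) = b.repr v a * B (b a) (b a) := by
      intro v a
      conv_lhs => rw [← b.sum_repr v]
      rw [map_sum, LinearMap.sum_apply, Finset.sum_eq_single a]
      · simp
      · intro c _ hc
        rw [map_smul, LinearMap.smul_apply]
        have : B (b c) (b a) = 0 := hb hc
        simp [this]
      · simp
    conv_lhs => rw [← b.sum_repr v]
    rw [map_sum]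
    refine Finset.sum_congr rfl fun a _ => ?_
    rw [hv v a, map_smul, smul_eq_mul]
    have := (hpos a).ne'
    field_simp
  refine ⟨_, fun x a => fischer m (zon x k) (b a).1 /
    Real.sqrt (B (b a) (b a) * (g * k.factorial)), finrank_harm_le m k (by omega), ?_⟩
  intro x y hx hy
  have hmem : ∀ x : EuclideanSpace ℝ (Fin m), ‖x‖ = 1 → zon (fun i => x i) k ∈ harm m k :=
    fun x hx => ⟨zon_homog _ k, lapl_zon hm _ (hsum x hx) k⟩
  have key : fischer m (zon x k) (zon y k) = g * k.factorial * (geg m k).eval ⟪x, y⟫ := by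
    obtain ⟨Q, hQ⟩ := hQ x
    rw [hQ, map_add, LinearMap.add_apply, fischer_nsq_mul, lapl_zon hm _ (hsum y hy),
      ← MvPolynomial.smul_eq_C_mul, map_smul, LinearMap.smul_apply,
      fischer_linf_pow _ _ _ (zon_homog _ k), zon_eval _ _ (hsum x hx)]
    simp [PiLp.inner_apply, mul_assoc]
  have h := hexp ⟨_, hmem x hx⟩ ⟨_, hmem y hy⟩
  rw [hBapp] at h
  have h' : (geg m k).eval ⟪x, y⟫ = (g * k.factorial)⁻¹ * fischer m (zon x k) (zon y k) := by
    rw [key]; field_simp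
  rw [h']
  erw [h]
  rw [Finset.mul_sum]
  refine Finset.sum_congr rfl fun a _ => ?_
  rw [div_mul_div_comm, Real.mul_self_sqrt (mul_pos (hpos a) hgk).le]
  have := (hpos a).ne'
  rw [hBapp, hBapp]
  field_simp

end Zonal

section OneDim

variable {m : ℕ}

theorem geg_rec (hm : 2 ≤ m) (k : ℕ) :
    Polynomial.X * geg m (k + 1) = lamG m (k + 2) • geg m (k + 2) + (1 - lamG m k) • geg m k := by
  rw [geg, smul_smul, mul_inv_cancel₀ (lamG_pos hm (k + 2) (by omega)).ne', one_smul]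
  abel

theorem geg_rec_zero (hm : 2 ≤ m) : Polynomial.X * geg m 0 = lamG m 1 • geg m 1 := by
  have h : lamG m 1 * m = 1 := by
    have h1 : (2:ℝ) ≤ m := by exact_mod_cast hm
    unfold lamG
    push_cast
    rw [show (m:ℝ) + 2 * 1 - 2 = m by ring]
    field_simp
  rw [geg, geg, Polynomial.smul_eq_C_mul, ← mul_assoc, ← Polynomial.C_mul, h]
  simp

/-- Uniform form of the recurrence. -/
theorem geg_rec' (hm : 2 ≤ m) (k : ℕ) :
    ∃ μ : ℝ, (k = 0 → μ = 0) ∧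
      Polynomial.X * geg m k = lamG m (k + 1) • geg m (k + 1) + μ • geg m (k - 1) := by
  cases k with
  | zero => exact ⟨0, fun _ => rfl, by simpa using geg_rec_zero hm⟩
  | succ k => exact ⟨1 - lamG m k, by simp, geg_rec hm k⟩

/-- Span of a range of Gegenbauer polynomials. -/
noncomputable def gspan (m a b : ℕ) : Submodule ℝ (Polynomial ℝ) :=
  Submodule.span ℝ (geg m '' Set.Ico a b)

theorem geg_mem_gspan {a b k : ℕ} (h1 : a ≤ k) (h2 : k < b) : geg m k ∈ gspan m a b :=
  Submodule.subset_span ⟨k, ⟨h1, h2⟩, rfl⟩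

theorem gspan_mono {a b a' b' : ℕ} (h1 : a' ≤ a) (h2 : b ≤ b') : gspan m a b ≤ gspan m a' b' :=
  Submodule.span_mono (Set.image_mono (Set.Ico_subset_Ico h1 h2))

theorem X_mul_gspan (hm : 2 ≤ m) {a b : ℕ} {p : Polynomial ℝ} (hp : p ∈ gspan m (a + 1) b) :
    Polynomial.X * p ∈ gspan m a (b + 1) := by
  have : gspan m (a + 1) b ≤ (gspan m a (b + 1)).comap (LinearMap.mulLeft ℝ Polynomial.X) := by
    rw [gspan, Submodule.span_le]
    rintro _ ⟨k, ⟨hk1, hk2⟩, rfl⟩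
    change Polynomial.X * geg m k ∈ gspan m a (b + 1)
    obtain ⟨k, rfl⟩ : ∃ l, k = l + 1 := ⟨k - 1, by omega⟩
    rw [geg_rec hm]
    exact add_mem (Submodule.smul_mem _ _ (geg_mem_gspan (by omega) (by omega)))
      (Submodule.smul_mem _ _ (geg_mem_gspan (by omega) (by omega)))
  exact this hp

theorem geg_prod (hm : 2 ≤ m) (a b : ℕ) (hab : a ≤ b) :
    ∃ c : ℝ, c ≠ 0 ∧ geg m a * geg m b - c • geg m (a + b) ∈ gspan m (b - a) (a + b) := by
  have hm' : (2:ℝ) ≤ m := by exact_mod_cast hm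
  induction a using Nat.twoStepInduction with
  | zero =>
    refine ⟨1, one_ne_zero, ?_⟩
    simp [geg]
  | one =>
    obtain ⟨b, rfl⟩ : ∃ l, b = l + 1 := ⟨b - 1, by omega⟩
    have hl := lamG_pos hm (b + 2) (by omega)
    refine ⟨m * lamG m (b + 2), by positivity, ?_⟩
    have : geg m 1 * geg m (b + 1) - ((m:ℝ) * lamG m (b + 2)) • geg m (1 + (b + 1))
        = ((m:ℝ) * (1 - lamG m b)) • geg m b := by
      rw [show geg m 1 = Polynomial.C (m : ℝ) * Polynomial.X by rw [geg], mul_assoc, geg_rec hm,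
        show 1 + (b + 1) = b + 2 by omega, ← Polynomial.smul_eq_C_mul, smul_add, smul_smul,
        smul_smul]
      abel
    rw [this]
    exact Submodule.smul_mem _ _ (geg_mem_gspan (by omega) (by omega))
  | more a ih1 ih2 =>
    obtain ⟨c1, hc1, h1⟩ := ih1 (by omega)
    obtain ⟨c2, hc2, h2⟩ := ih2 (by omega)
    have hl := lamG_pos hm (a + 2) (by omega)
    have hl2 := lamG_pos hm (a + b + 2) (by omega)
    refine ⟨(lamG m (a + 2))⁻¹ * (c2 * lamG m (a + b + 2)), by positivity, ?_⟩
    have hr := geg_rec hm (a + b)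
    rw [show b - (a + 1) = b - (a + 2) + 1 by omega] at h2
    have h2' := X_mul_gspan hm h2
    have : geg m (a + 2) * geg m b
          - ((lamG m (a + 2))⁻¹ * (c2 * lamG m (a + b + 2))) • geg m (a + 2 + b)
        = (lamG m (a + 2))⁻¹ • (Polynomial.X * (geg m (a + 1) * geg m b
              - c2 • geg m (a + 1 + b)) + (c2 * (1 - lamG m (a + b))) • geg m (a + b)
            - (1 - lamG m a) • ((geg m a * geg m b - c1 • geg m (a + b))
              + c1 • geg m (a + b))) := by
      rw [show a + 1 + b = a + b + 1 by omega, show a + 2 + b = a + b + 2 by omega, mul_sub,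
        mul_smul_comm, hr]
      rw [show geg m (a + 2) = (lamG m (a + 2))⁻¹ •
      (Polynomial.X * geg m (a + 1) - (1 - lamG m a) • geg m a) by rw [geg]]
      simp only [Polynomial.smul_eq_C_mul, map_mul]
      ring
    rw [this]
    refine Submodule.smul_mem _ _ (sub_mem (add_mem ?_ ?_) (Submodule.smul_mem _ _ (add_mem ?_ ?_)))
    · exact gspan_mono (by omega) (by omega) h2'
    · exact Submodule.smul_mem _ _ (geg_mem_gspan (by omega) (by omega))
    · exact gspan_mono (by omega) (by omega) h1
    · exact Submodule.smul_mem _ _ (geg_mem_gspan (by omega) (by omega))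

variable (S : Polynomial ℝ →ₗ[ℝ] ℝ) (T : ℕ)

theorem S_gspan (hS : ∀ l, 1 ≤ l → l ≤ T → S (geg m l) = 0) {a b : ℕ} (ha : 1 ≤ a)
    (hb : b ≤ T + 1) {p : Polynomial ℝ} (hp : p ∈ gspan m a b) : S p = 0 := by
  have : gspan m a b ≤ LinearMap.ker S := by
    rw [gspan, Submodule.span_le]
    rintro _ ⟨k, ⟨hk1, hk2⟩, rfl⟩
    exact hS k (by omega) (by omega)
  exact this hp

theorem S_prod_zero (hm : 2 ≤ m) (hS : ∀ l, 1 ≤ l → l ≤ T → S (geg m l) = 0) {a b : ℕ}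
    (hab : a < b) (hT : a + b ≤ T) : S (geg m a * geg m b) = 0 := by
  obtain ⟨c, _, h⟩ := geg_prod hm a b hab.le
  have h1 := S_gspan S T hS (by omega) (by omega) h
  rw [map_sub, map_smul, hS _ (by omega) hT] at h1
  simpa using h1

theorem S_prod_ne (hm : 2 ≤ m) (hS : ∀ l, 1 ≤ l → l ≤ T → S (geg m l) = 0) {a b : ℕ}
    (hab : a < b) (hT : a + b = T + 1) (hne : S (geg m (T + 1)) ≠ 0) :
    S (geg m a * geg m b) ≠ 0 := by
  obtain ⟨c, hc, h⟩ := geg_prod hm a b hab.le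
  have h1 := S_gspan S T hS (by omega) (by omega) h
  rw [map_sub, map_smul, hT, sub_eq_zero] at h1
  rw [h1]
  exact mul_ne_zero hc hne

theorem geg_one_rec (hm : 2 ≤ m) (k : ℕ) :
    lamG m (k + 1) * (geg m (k + 1)).eval 1 = (1 - lamG m k) * (geg m k).eval 1 := by
  induction k with
  | zero =>
    have := congrArg (Polynomial.eval 1) (geg_rec_zero hm)
    simp only [Polynomial.eval_mul, Polynomial.eval_X, Polynomial.eval_smul, smul_eq_mul] at this
    rw [zero_add, ← this, lamG_zero]
    ring
  | succ k ih =>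
    have := congrArg (Polynomial.eval 1) (geg_rec hm k)
    simp only [Polynomial.eval_mul, Polynomial.eval_X, Polynomial.eval_smul, smul_eq_mul,
      Polynomial.eval_add] at this
    linarith

theorem S_sq (hm : 2 ≤ m) (hS : ∀ l, 1 ≤ l → l ≤ T → S (geg m l) = 0) (a : ℕ)
    (hT : 2 * a ≤ T) : S (geg m a * geg m a) = S 1 * (geg m a).eval 1 := by
  induction a with
  | zero => simp [geg]
  | succ a ih =>
    have ih := ih (by omega)
    have hl := lamG_pos hm (a + 1) (by omega)
    obtain ⟨μ, hμ, hr⟩ := geg_rec' hm a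
    have hr2 := geg_rec hm a
    have e1 : S (Polynomial.X * geg m a * geg m (a + 1))
        = lamG m (a + 1) * S (geg m (a + 1) * geg m (a + 1)) := by
      rw [hr, add_mul, smul_mul_assoc, smul_mul_assoc, map_add, map_smul, map_smul,
        S_prod_zero S T hm hS (a := a - 1) (b := a + 1) (by omega) (by omega)]
      simp
    have e2 : S (Polynomial.X * geg m a * geg m (a + 1))
        = (1 - lamG m a) * S (geg m a * geg m a) := by
      rw [mul_right_comm, hr2, add_mul, smul_mul_assoc, smul_mul_assoc, map_add, map_smul,
        map_smul, mul_comm (geg m (a + 2)),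
        S_prod_zero S T hm hS (a := a) (b := a + 2) (by omega) (by omega)]
      simp
    have e3 := geg_one_rec hm a
    apply mul_left_cancel₀ hl.ne'
    rw [← e1, e2, ih]
    linear_combination - S 1 * e3

theorem hdim_closed (n k : ℕ) :
    hdim (n + 2) (k + 1) = (n + k + 1).choose n + (n + k).choose n := by
  unfold hdim
  cases k with
  | zero =>
    simp [Nat.choose_succ_self_right]
  | succ k =>
    rw [if_pos (by omega)]
    have e1 : (n + 2 + (k + 1 + 1) - 1).choose (k + 1 + 1) = (n + k + 3).choose (n + 1) := by
      rw [show n + 2 + (k + 1 + 1) - 1 = n + k + 3 by omega]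
      exact Nat.choose_symm_of_eq_add (by omega)
    have e2 : (n + 2 + (k + 1 + 1) - 3).choose (k + 1 + 1 - 2) = (n + k + 1).choose (n + 1) := by
      rw [show n + 2 + (k + 1 + 1) - 3 = n + k + 1 by omega]
      exact Nat.choose_symm_of_eq_add (by omega)
    rw [e1, e2, Nat.choose_succ_succ (n + k + 2), Nat.choose_succ_succ (n + k + 1)]
    rw [show n + (k + 1) + 1 = n + k + 2 by omega, show n + (k + 1) = n + k + 1 by omega]
    simp only [Nat.succ_eq_add_one]
    omega

theorem hdim_mul (n k : ℕ) :
    (hdim (n + 2) (k + 1)) * (k + 1) = (n + 2 * (k + 1)) * (n + k).choose n := by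
  rw [hdim_closed]
  have h := Nat.add_one_mul_choose_eq (n + k) k
  have e1 : (n + k).choose k = (n + k).choose n := Nat.choose_symm_of_eq_add (by omega)
  have e2 : (n + k + 1).choose (k + 1) = (n + k + 1).choose n :=
    Nat.choose_symm_of_eq_add (by omega)
  rw [e1, e2] at h
  rw [add_mul, ← h]
  ring

theorem geg_one (hm : 2 ≤ m) (k : ℕ) : (geg m k).eval 1 = hdim m k := by
  obtain ⟨n, rfl⟩ : ∃ n, m = n + 2 := ⟨m - 2, by omega⟩
  induction k with
  | zero => simp [geg, hdim]
  | succ k ih =>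
    have hl := lamG_pos hm (k + 1) (by omega)
    apply mul_left_cancel₀ hl.ne'
    rw [geg_one_rec hm, ih]
    cases k with
    | zero =>
      have h := hdim_mul n 0
      have h' : (hdim (n + 2) 1 : ℝ) = n + 2 := by
        simp at h
        exact_mod_cast h
      have h0 : hdim (n + 2) 0 = 1 := by simp [hdim]
      rw [h0, lamG_zero, h']
      unfold lamG
      push_cast
      have : (n:ℝ) + 2 ≠ 0 := by positivity
      rw [show (n:ℝ) + 2 + 2 * 1 - 2 = n + 2 by ring]
      field_simp
      ring
    | succ k =>
      have h1 : (hdim (n + 2) (k + 1) : ℝ) * (k + 1) = (n + 2 * (k + 1)) * (n + k).choose n := by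
        exact_mod_cast hdim_mul n k
      have h2 : (hdim (n + 2) (k + 2) : ℝ) * (k + 2)
          = (n + 2 * (k + 2)) * (n + k + 1).choose n := by
        exact_mod_cast hdim_mul n (k + 1)
      have h3 : ((n + k + 1).choose n : ℝ) * (k + 1) = (n + k + 1) * (n + k).choose n := by
        have h := Nat.add_one_mul_choose_eq (n + k) k
        have e1 : (n + k).choose k = (n + k).choose n := Nat.choose_symm_of_eq_add (by omega)
        have e2 : (n + k + 1).choose (k + 1) = (n + k + 1).choose n :=
          Nat.choose_symm_of_eq_add (by omega)
        rw [e1, e2] at h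
        exact_mod_cast h.symm
      have hk1 : (k:ℝ) + 1 ≠ 0 := by positivity
      have hk2 : (k:ℝ) + 2 ≠ 0 := by positivity
      have g1 : (n:ℝ) + 2 * k + 2 ≠ 0 := by positivity
      have g2 : (n:ℝ) + 2 * k + 4 ≠ 0 := by positivity
      rw [← eq_div_iff hk1] at h1 h3
      rw [← eq_div_iff hk2] at h2
      rw [h2, h1, h3]
      unfold lamG
      push_cast
      rw [show (n:ℝ) + 2 + 2 * (k + 1) - 2 = n + 2 * k + 2 by ring,
        show (n:ℝ) + 2 + 2 * (k + 1 + 1) - 2 = n + 2 * k + 4 by ring]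
      field_simp
      ring

/-- `p` is an even polynomial of degree exactly `2n`, in terms of the Gegenbauer basis. -/
def EvenGood (m n : ℕ) (p : Polynomial ℝ) : Prop :=
  ∃ c : ℝ, c ≠ 0 ∧
    p - c • geg m (2 * n) ∈ Submodule.span ℝ ((fun k => geg m (2 * k)) '' Set.Iio n)

theorem X2_geg (hm : 2 ≤ m) (k : ℕ) : ∃ α β γ : ℝ, α ≠ 0 ∧ (k = 0 → γ = 0) ∧
    Polynomial.X ^ 2 * geg m (2 * k) = α • geg m (2 * (k + 1)) + β • geg m (2 * k)
      + γ • geg m (2 * (k - 1)) := by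
  cases k with
  | zero =>
    have h := geg_rec_zero hm
    have h1 := geg_rec hm 0
    refine ⟨lamG m 1 * lamG m 2, lamG m 1 * (1 - lamG m 0), 0,
      (mul_pos (lamG_pos hm 1 le_rfl) (lamG_pos hm 2 (by omega))).ne', fun _ => rfl, ?_⟩
    rw [zero_add] at h1
    rw [pow_two, mul_assoc, mul_zero, h, mul_smul_comm, h1]
    simp only [Polynomial.smul_eq_C_mul, map_mul]
    simp
    ring
  | succ k =>
    have h := geg_rec hm (2 * k + 1)
    have h1 := geg_rec hm (2 * k)
    have h2 := geg_rec hm (2 * k + 2)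
    refine ⟨lamG m (2 * k + 3) * lamG m (2 * k + 4), lamG m (2 * k + 3) * (1 - lamG m (2 * k + 2))
      + (1 - lamG m (2 * k + 1)) * lamG m (2 * k + 2), (1 - lamG m (2 * k + 1)) * (1 - lamG m (2 * k)),
      (mul_pos (lamG_pos hm _ (by omega)) (lamG_pos hm _ (by omega))).ne', by simp, ?_⟩
    rw [show 2 * (k + 1) = 2 * k + 1 + 1 by omega, show 2 * (k + 1 + 1) = 2 * k + 4 by omega,
      pow_two, mul_assoc, h, mul_add, mul_smul_comm, mul_smul_comm, h1,
      show 2 * k + 1 + 2 = 2 * k + 2 + 1 by omega, h2, show k + 1 - 1 = k by omega]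
    simp only [Polynomial.smul_eq_C_mul, map_mul, map_add]
    simp only [show 2 * k + 2 + 1 = 2 * k + 3 by omega, show 2 * k + 2 + 2 = 2 * k + 4 by omega,
      show 2 * k + 1 + 1 = 2 * k + 2 by omega]
    ring

theorem EvenGood.step (hm : 2 ≤ m) {n : ℕ} {p : Polynomial ℝ} (hp : EvenGood m n p) (b : ℝ) :
    EvenGood m (n + 1) ((Polynomial.X ^ 2 - Polynomial.C b) * p) := by
  obtain ⟨c, hc, h⟩ := hp
  obtain ⟨α, β, γ, hα, hγ, hx⟩ := X2_geg hm n
  have hle : Submodule.span ℝ ((fun k => geg m (2 * k)) '' Set.Iio n) ≤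
      (Submodule.span ℝ ((fun k => geg m (2 * k)) '' Set.Iio (n + 1))).comap
        (LinearMap.mulLeft ℝ (Polynomial.X ^ 2 - Polynomial.C b)) := by
    rw [Submodule.span_le]
    rintro _ ⟨k, hk, rfl⟩
    obtain ⟨α, β, γ, hα, hγ, hx⟩ := X2_geg hm k
    change (Polynomial.X ^ 2 - Polynomial.C b) * geg m (2 * k) ∈
      Submodule.span ℝ ((fun k => geg m (2 * k)) '' Set.Iio (n + 1))
    rw [sub_mul, hx, ← Polynomial.smul_eq_C_mul]
    have hk' : k < n := hk
    have hmem : ∀ l < n + 1, ∀ a : ℝ, a • geg m (2 * l) ∈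
      Submodule.span ℝ ((fun k => geg m (2 * k)) '' Set.Iio (n + 1)) := fun l hl a =>
        Submodule.smul_mem _ _ (Submodule.subset_span ⟨l, hl, rfl⟩)
    exact sub_mem (add_mem (add_mem (hmem _ (by omega) _) (hmem _ (by omega) _))
      (hmem _ (by omega) _)) (hmem _ (by omega) _)
  refine ⟨c * α, mul_ne_zero hc hα, ?_⟩
  have hmem : ∀ l < n + 1, ∀ a : ℝ, a • geg m (2 * l) ∈
      Submodule.span ℝ ((fun k => geg m (2 * k)) '' Set.Iio (n + 1)) := fun l hl a =>
        Submodule.smul_mem _ _ (Submodule.subset_span ⟨l, hl, rfl⟩)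
  have e : (Polynomial.X ^ 2 - Polynomial.C b) * p - (c * α) • geg m (2 * (n + 1))
      = (Polynomial.X ^ 2 - Polynomial.C b) * (p - c • geg m (2 * n))
        + ((c * β - b * c) • geg m (2 * n) + (c * γ) • geg m (2 * (n - 1))) := by
    simp only [Polynomial.smul_eq_C_mul, map_mul, map_sub] at hx ⊢
    linear_combination Polynomial.C c * hx
  rw [e]
  exact add_mem (hle h) (add_mem (hmem _ (by omega) _) (hmem _ (by omega) _))

theorem EvenGood.expand {n : ℕ} {p : Polynomial ℝ} (hp : EvenGood m n p) :
    ∃ f : ℕ → ℝ, f n ≠ 0 ∧ p = ∑ k ∈ Finset.range (n + 1), f k • geg m (2 * k) := by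
  obtain ⟨c, hc, h⟩ := hp
  have : (Set.Iio n : Set ℕ) = ↑(Finset.range n) := by ext; simp
  rw [this, Submodule.mem_span_image_finset_iff_exists_fun] at h
  obtain ⟨f', hf'⟩ := h
  obtain ⟨f, hf⟩ : ∃ f : ℕ → ℝ, ∑ k ∈ Finset.range n, f k • geg m (2 * k)
      = p - c • geg m (2 * n) := by
    refine ⟨fun k => if h : k ∈ Finset.range n then f' ⟨k, h⟩ else 0, ?_⟩
    rw [← hf', ← Finset.sum_coe_sort]
    refine Finset.sum_congr rfl fun k _ => ?_
    simp only [dif_pos k.2]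
  refine ⟨fun k => if k = n then c else f k, by simpa using hc, ?_⟩
  rw [Finset.sum_range_succ]
  have : ∑ k ∈ Finset.range n, (if k = n then c else f k) • geg m (2 * k)
      = ∑ k ∈ Finset.range n, f k • geg m (2 * k) := by
    refine Finset.sum_congr rfl fun k hk => ?_
    rw [if_neg (Finset.mem_range.mp hk).ne]
  rw [this, hf]
  simp

theorem evenGood_prod (hm : 2 ≤ m) (B : Finset ℝ) :
    EvenGood m B.card (∏ b ∈ B, (Polynomial.X ^ 2 - Polynomial.C b)) := by
  induction B using Finset.induction_on with
  | empty => exact ⟨1, one_ne_zero, by simp [geg]⟩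
  | insert b B hb ih =>
    rw [Finset.prod_insert hb, Finset.card_insert_of_notMem hb]
    exact ih.step hm b

theorem evenGood_pow (hm : 2 ≤ m) {n : ℕ} {p : Polynomial ℝ} (hp : EvenGood m n p) (r : ℕ) :
    EvenGood m (n + r) ((Polynomial.X ^ 2) ^ r * p) := by
  induction r with
  | zero => simpa using hp
  | succ r ih =>
    have := ih.step hm 0
    rw [map_zero, sub_zero, ← mul_assoc, ← pow_succ'] at this
    exact this

end OneDim

section MatrixPart

variable {ι : Type*} [Fintype ι]

theorem matrix_rank_add_le (A B : Matrix ι ι ℝ) : (A + B).rank ≤ A.rank + B.rank := by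
  unfold Matrix.rank
  refine le_trans (Submodule.finrank_mono ?_) (Submodule.finrank_add_le_finrank_add_finrank _ _)
  rintro _ ⟨v, rfl⟩
  rw [Matrix.mulVecLin_add, LinearMap.add_apply]
  exact Submodule.add_mem_sup ⟨v, rfl⟩ ⟨v, rfl⟩

theorem matrix_rank_smul_le (c : ℝ) (A : Matrix ι ι ℝ) : (c • A).rank ≤ A.rank := by
  classical
  have : c • A = A * (c • (1 : Matrix ι ι ℝ)) := by simp
  rw [this]
  exact Matrix.rank_mul_le_left _ _

theorem matrix_rank_sum_le (s : Finset ℕ) (M : ℕ → Matrix ι ι ℝ) (f : ℕ → ℝ) (h : ℕ → ℕ)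
    (hM : ∀ k, (M k).rank ≤ h k) : (∑ k ∈ s, f k • M k).rank ≤ ∑ k ∈ s, h k := by
  induction s using Finset.induction_on with
  | empty => simp
  | insert a s ha ih =>
    rw [Finset.sum_insert ha, Finset.sum_insert ha]
    exact (matrix_rank_add_le _ _).trans
      (add_le_add ((matrix_rank_smul_le _ _).trans (hM a)) ih)

theorem gram_mul_zero {α β : Type*} [Fintype α] [Fintype β] (H : Matrix ι α ℝ) (K : Matrix ι β ℝ)
    (h : ((H * H.transpose) * (K * K.transpose)).trace = 0) :
    (H * H.transpose) * (K * K.transpose) = 0 := by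
  have h1 : ((H.transpose * K) * (H.transpose * K).conjTranspose).trace = 0 := by
    rw [Matrix.conjTranspose_eq_transpose_of_trivial, Matrix.transpose_mul,
      Matrix.transpose_transpose, ← h, Matrix.mul_assoc, Matrix.trace_mul_comm]
    rw [Matrix.mul_assoc, Matrix.mul_assoc, Matrix.trace_mul_comm]
    simp only [Matrix.mul_assoc]
    rw [Matrix.trace_mul_comm]
    simp only [Matrix.mul_assoc]
  rw [Matrix.trace_mul_conjTranspose_self_eq_zero_iff] at h1
  calc (H * H.transpose) * (K * K.transpose) = H * (H.transpose * K) * K.transpose := by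
        simp only [Matrix.mul_assoc]
    _ = 0 := by rw [h1]; simp

theorem gram_sq {d h : ℕ} (hd : d ≤ h) (H : Matrix ι (Fin d) ℝ) (N : ℝ)
    (h1 : (H * H.transpose).trace = N * h)
    (h2 : ((H * H.transpose) * (H * H.transpose)).trace = N ^ 2 * h) :
    (H * H.transpose) * (H * H.transpose) = N • (H * H.transpose) := by
  set B := H.transpose * H with hB
  have hBt : B.transpose = B := by simp [hB, Matrix.transpose_mul]
  have t1 : B.trace = N * h := by rw [hB, Matrix.trace_mul_comm, h1]
  have t2 : (B * B).trace = N ^ 2 * h := by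
    rw [← h2, hB, Matrix.mul_assoc, Matrix.trace_mul_comm]
    congr 1
    simp only [Matrix.mul_assoc]
  have t3 : ((B - N • 1) * (B - N • 1).conjTranspose).trace = N ^ 2 * (d - h) := by
    rw [Matrix.conjTranspose_eq_transpose_of_trivial, Matrix.transpose_sub, hBt,
      Matrix.transpose_smul, Matrix.transpose_one, Matrix.sub_mul, Matrix.mul_sub, Matrix.mul_sub]
    simp only [Matrix.trace_sub, Matrix.mul_smul, Matrix.smul_mul, Matrix.mul_one, Matrix.one_mul,
      Matrix.trace_smul, Matrix.trace_one, t1, t2, Fintype.card_fin, smul_eq_mul]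
    ring
  have t4 : 0 ≤ ((B - N • 1) * (B - N • 1).conjTranspose).trace :=
    (Matrix.posSemidef_self_mul_conjTranspose _).trace_nonneg
  have hd' : (d:ℝ) ≤ h := by exact_mod_cast hd
  have t5 : ((B - N • 1) * (B - N • 1).conjTranspose).trace = 0 := by
    refine le_antisymm ?_ t4
    rw [t3]
    exact mul_nonpos_of_nonneg_of_nonpos (sq_nonneg _) (by linarith)
  rw [Matrix.trace_mul_conjTranspose_self_eq_zero_iff, sub_eq_zero] at t5
  calc (H * H.transpose) * (H * H.transpose) = H * B * H.transpose := by
        simp only [hB, Matrix.mul_assoc]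
    _ = _ := by rw [t5]; simp

theorem rank_core_a (r : ℕ) (M : ℕ → Matrix ι ι ℝ) (h : ℕ → ℕ) (hM : ∀ k, (M k).rank ≤ h k)
    (J : Matrix ι ι ℝ) (F1 : ℝ) (hF : F1 ≠ 0) (f : ℕ → ℝ)
    (hsum : ∑ k ∈ Finset.range (r + 1), f k • M k = F1 • J) :
    J.rank ≤ ∑ k ∈ Finset.range (r + 1), h k := by
  have : J = F1⁻¹ • ∑ k ∈ Finset.range (r + 1), f k • M k := by
    rw [hsum, smul_smul, inv_mul_cancel₀ hF, one_smul]
  rw [this]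
  exact (matrix_rank_smul_le _ _).trans (matrix_rank_sum_le _ _ _ _ hM)

theorem rank_core_b (r j : ℕ) (hj : j < r) (M : ℕ → Matrix ι ι ℝ) (h : ℕ → ℕ)
    (hM : ∀ k, (M k).rank ≤ h k)
    (J : Matrix ι ι ℝ) (F1 : ℝ) (hF : F1 ≠ 0) (f : ℕ → ℝ) (hfr : f r ≠ 0)
    (hsum : ∑ k ∈ Finset.range (r + 1), f k • M k = F1 • J)
    (hJ : J * M j = (2:ℝ) • M j) (hz : ∀ k < r, k ≠ j → M k * M j = 0) (N : ℝ)
    (hN : M j * M j = N • M j) (hne : M r * M j ≠ 0) :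
    J.rank + h j ≤ ∑ k ∈ Finset.range (r + 1), h k := by
  classical
  have hjr : j ∈ Finset.range r := Finset.mem_range.mpr hj
  have e1 : (2 * F1 - f j * N) • M j = f r • (M r * M j) := by
    have := congrArg (· * M j) hsum
    simp only [Finset.sum_mul, Matrix.smul_mul, hJ] at this
    rw [Finset.sum_range_succ, ← Finset.add_sum_erase _ _ hjr, hN, Finset.sum_eq_zero] at this
    · rw [smul_smul, smul_smul, add_zero] at this
      rw [sub_smul, mul_comm 2 F1, ← this]
      abel
    · intro k hk
      rw [Finset.mem_erase, Finset.mem_range] at hk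
      rw [hz k hk.2 hk.1, smul_zero]
  set a := 2 * F1 - f j * N with ha
  have ha0 : a ≠ 0 := by
    intro h0
    rw [h0, zero_smul] at e1
    exact (smul_ne_zero hfr hne) e1.symm
  have e2 : M j = (a⁻¹ * f r) • (M r * M j) := by
    rw [← smul_smul, ← e1, smul_smul, inv_mul_cancel₀ ha0, one_smul]
  have e3 : F1 • J = ∑ k ∈ (Finset.range r).erase j, f k • M k
      + M r * (f r • (1 : Matrix ι ι ℝ) + (f j * (a⁻¹ * f r)) • M j) := by
    rw [← hsum, Finset.sum_range_succ, ← Finset.add_sum_erase _ _ hjr, Matrix.mul_add,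
      Matrix.mul_smul, Matrix.mul_one, Matrix.mul_smul, ← smul_smul, ← e2]
    abel
  have e4 : J = F1⁻¹ • (∑ k ∈ (Finset.range r).erase j, f k • M k
      + M r * (f r • (1 : Matrix ι ι ℝ) + (f j * (a⁻¹ * f r)) • M j)) := by
    rw [← e3, smul_smul, inv_mul_cancel₀ hF, one_smul]
  have e5 : J.rank ≤ ∑ k ∈ (Finset.range r).erase j, h k + h r := by
    rw [e4]
    refine (matrix_rank_smul_le _ _).trans ((matrix_rank_add_le _ _).trans (add_le_add ?_ ?_))
    · exact matrix_rank_sum_le _ _ _ _ hM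
    · exact (Matrix.rank_mul_le_left _ _).trans (hM r)
  rw [Finset.sum_range_succ, ← Finset.add_sum_erase _ _ hjr]
  omega

theorem trace_le_rank [DecidableEq ι] (J : Matrix ι ι ℝ) (hJ : J * J = (2:ℝ) • J) :
    J.trace = 2 * J.rank := by
  set P := (2⁻¹ : ℝ) • J with hP
  have hPP : P * P = P := by
    rw [hP, Matrix.smul_mul, Matrix.mul_smul, hJ, smul_smul, smul_smul]
    norm_num
  have he : IsIdempotentElem (Matrix.toLin' P) := by
    change Matrix.toLin' P * Matrix.toLin' P = Matrix.toLin' P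
    rw [Module.End.mul_eq_comp, ← Matrix.toLin'_mul, hPP]
  have ht := (LinearMap.IsIdempotentElem.isProj_range _ he).trace
  rw [Matrix.trace_toLin'_eq] at ht
  have h1 : P.trace = (P.rank : ℝ) := ht
  have h2 : P.rank = J.rank := by
    apply le_antisymm (matrix_rank_smul_le _ _)
    have : J = (2:ℝ) • P := by rw [hP, smul_smul]; norm_num
    conv_lhs => rw [this]
    exact matrix_rank_smul_le _ _
  rw [h2, hP, Matrix.trace_smul, smul_eq_mul] at h1
  linarith

end MatrixPart

theorem card_sq_image (A : Finset ℝ) (hA : ∀ a ∈ A, -a ∈ A) :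
    2 * (A.image (fun a => a ^ 2)).card ≤ A.card + 1 := by
  classical
  have h1 : (A.image (fun a => a ^ 2)).card ≤ (A.filter (fun a => 0 ≤ a)).card := by
    refine le_trans (Finset.card_le_card ?_)
      (Finset.card_image_le (s := A.filter (fun a => 0 ≤ a)) (f := fun a => a ^ 2))
    intro b hb
    obtain ⟨a, ha, rfl⟩ := Finset.mem_image.mp hb
    rcases le_total 0 a with h | h
    · exact Finset.mem_image.mpr ⟨a, Finset.mem_filter.mpr ⟨ha, h⟩, rfl⟩
    · exact Finset.mem_image.mpr ⟨-a, Finset.mem_filter.mpr ⟨hA a ha, by linarith⟩, by simp⟩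
  have h2 : (A.filter (fun a => 0 ≤ a)).card ≤ (A.filter (fun a => a ≤ 0)).card := by
    refine Finset.card_le_card_of_injOn (fun a => -a) ?_ (fun a _ b _ h => neg_injective h)
    intro a ha
    have ha := Finset.mem_filter.mp ha
    exact Finset.mem_coe.mpr (Finset.mem_filter.mpr ⟨hA a ha.1, by linarith [ha.2]⟩)
  have h3 := Finset.card_union_add_card_inter (A.filter (fun a => 0 ≤ a))
    (A.filter (fun a => a ≤ 0))
  have h4 : ((A.filter (fun a => 0 ≤ a)) ∪ (A.filter (fun a => a ≤ 0))).card ≤ A.card :=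
    Finset.card_le_card (Finset.union_subset (Finset.filter_subset _ _) (Finset.filter_subset _ _))
  have h5 : ((A.filter (fun a => 0 ≤ a)) ∩ (A.filter (fun a => a ≤ 0))).card ≤ 1 := by
    refine (Finset.card_le_card (t := {0}) ?_).trans (by simp)
    intro a ha
    simp only [Finset.mem_inter, Finset.mem_filter] at ha
    simp only [Finset.mem_singleton]
    linarith [ha.1.2, ha.2.2]
  omega

section Main

variable {m : ℕ}

/-- Sum of a polynomial over all pairs. -/
noncomputable def pairSum (X : Finset (EuclideanSpace ℝ (Fin m))) : Polynomial ℝ →ₗ[ℝ] ℝ :=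
  ∑ x ∈ X, ∑ y ∈ X, Polynomial.leval ⟪x, y⟫

theorem pairSum_apply (X : Finset (EuclideanSpace ℝ (Fin m))) (p : Polynomial ℝ) :
    pairSum X p = ∑ x ∈ X, ∑ y ∈ X, p.eval ⟪x, y⟫ := by
  simp [pairSum, LinearMap.sum_apply]

/-- The Gegenbauer matrices. -/
noncomputable def gmat (X : Finset (EuclideanSpace ℝ (Fin m))) (k : ℕ) : Matrix X X ℝ :=
  Matrix.of fun x y => (geg m k).eval ⟪x.1, y.1⟫

theorem trace_gmat_mul (X : Finset (EuclideanSpace ℝ (Fin m))) (a b : ℕ) :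
    (gmat X a * gmat X b).trace = pairSum X (geg m a * geg m b) := by
  rw [pairSum_apply, ← Finset.sum_coe_sort]
  simp only [Matrix.trace, Matrix.diag_apply, Matrix.mul_apply]
  refine Finset.sum_congr rfl fun x _ => ?_
  rw [← Finset.sum_coe_sort X (fun y => (geg m a * geg m b).eval ⟪x.1, y⟫)]
  refine Finset.sum_congr rfl fun y _ => ?_
  simp only [gmat, Matrix.of_apply, Polynomial.eval_mul]
  rw [real_inner_comm x.1 y.1]

theorem trace_gmat (hm : 2 ≤ m) (X : Finset (EuclideanSpace ℝ (Fin m))) (hX : ∀ x ∈ X, ‖x‖ = 1)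
    (a : ℕ) : (gmat X a).trace = X.card * hdim m a := by
  simp only [Matrix.trace, Matrix.diag_apply, gmat, Matrix.of_apply]
  have : ∀ x : X, (geg m a).eval ⟪x.1, x.1⟫ = hdim m a := by
    intro x
    rw [real_inner_self_eq_norm_sq, hX x.1 x.2, one_pow, geg_one hm]
  rw [Finset.sum_congr rfl (fun x _ => this x)]
  simp

theorem gmat_factor (hm : 2 ≤ m) (X : Finset (EuclideanSpace ℝ (Fin m))) (hX : ∀ x ∈ X, ‖x‖ = 1)
    (k : ℕ) : ∃ (d : ℕ) (H : Matrix X (Fin d) ℝ), d ≤ hdim m k ∧ gmat X k = H * H.transpose := by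
  obtain ⟨d, φ, hd, h⟩ := geg_factor hm k
  refine ⟨d, Matrix.of fun x a => φ x.1 a, hd, ?_⟩
  ext x y
  simp only [gmat, Matrix.of_apply, Matrix.mul_apply, Matrix.transpose_apply]
  exact h _ _ (hX _ x.2) (hX _ y.2)

theorem gmat_rank (hm : 2 ≤ m) (X : Finset (EuclideanSpace ℝ (Fin m))) (hX : ∀ x ∈ X, ‖x‖ = 1)
    (k : ℕ) : (gmat X k).rank ≤ hdim m k := by
  obtain ⟨d, H, hd, h⟩ := gmat_factor hm X hX k
  rw [h]
  refine (Matrix.rank_mul_le_left _ _).trans ((Matrix.rank_le_card_width _).trans ?_)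
  simpa using hd

theorem geg_even (k : ℕ) (x : ℝ) :
    (geg m (2 * k)).eval (-x) = (geg m (2 * k)).eval x := by
  have h : ∀ k, (geg m k).eval (-x) = (-1) ^ k * (geg m k).eval x := by
    intro k
    induction k using Nat.twoStepInduction with
    | zero => simp [geg]
    | one => simp [geg]
    | more k ih1 ih2 =>
      simp only [geg, Polynomial.eval_smul, Polynomial.eval_sub, Polynomial.eval_mul,
        Polynomial.eval_X, ih1, ih2, smul_eq_mul]
      ring
  rw [h]
  simp

theorem eq_zero_of_eq_neg_self {x : EuclideanSpace ℝ (Fin m)} (h : x = -x) : x = 0 := by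
  have h2 : (2:ℝ) • x = 0 := by
    rw [two_smul]
    nth_rewrite 1 [h]
    simp
  simpa using h2

theorem inner_ne_one {x y : EuclideanSpace ℝ (Fin m)} (hx : ‖x‖ = 1) (hy : ‖y‖ = 1)
    (h : ⟪x, y⟫ = 1) : x = y := (inner_eq_one_iff_of_norm_eq_one hx hy).mp h

theorem inner_neg_one {x y : EuclideanSpace ℝ (Fin m)} (hx : ‖x‖ = 1) (hy : ‖y‖ = 1)
    (h : ⟪x, y⟫ = -1) : x = -y := by
  apply inner_ne_one hx (by rwa [norm_neg])
  rw [inner_neg_right, h, neg_neg]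

theorem mem_innerSet {X : Finset (EuclideanSpace ℝ (Fin m))} {a : ℝ} :
    a ∈ innerSet m X ↔ ∃ x ∈ X, ∃ y ∈ X, x ≠ y ∧ ⟪x, y⟫ = a := by
  simp only [innerSet, Finset.mem_image, Finset.mem_filter, Finset.mem_product, Prod.exists]
  constructor
  · rintro ⟨x, y, ⟨⟨hx, hy⟩, hne⟩, h⟩
    exact ⟨x, hx, y, hy, hne, h⟩
  · rintro ⟨x, hx, y, hy, hne, h⟩
    exact ⟨x, y, ⟨⟨hx, hy⟩, hne⟩, h⟩

/-- The annihilator polynomial expanded in even Gegenbauer polynomials. -/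
theorem exists_annihilator (hm : 2 ≤ m) (X : Finset (EuclideanSpace ℝ (Fin m)))
    (hX : ∀ x ∈ X, ‖x‖ = 1) (hanti : ∀ x ∈ X, -x ∈ X) (hne : X.Nonempty) :
    ∃ (F1 : ℝ) (f : ℕ → ℝ), F1 ≠ 0 ∧ f ((innerSet m X).card / 2) ≠ 0 ∧
      ∀ x ∈ X, ∀ y ∈ X, ∑ k ∈ Finset.range ((innerSet m X).card / 2 + 1),
        f k * (geg m (2 * k)).eval ⟪x, y⟫ = F1 * ((if x = y then 1 else 0)
          + (if -x = y then 1 else 0)) := by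
  set A := (innerSet m X).erase (-1) with hA
  set B := A.image (fun a => a ^ 2) with hB
  have hx0 : ∀ x ∈ X, x ≠ -x := by
    intro x hx h
    have h0 : x = 0 := eq_zero_of_eq_neg_self h
    have := hX x hx
    rw [h0, norm_zero] at this
    exact zero_ne_one this
  have hAmem : ∀ a, a ∈ A ↔ ∃ x ∈ X, ∃ y ∈ X, x ≠ y ∧ x ≠ -y ∧ ⟪x, y⟫ = a := by
    intro a
    rw [hA, Finset.mem_erase, mem_innerSet]
    constructor
    · rintro ⟨ha, x, hx, y, hy, hxy, h⟩
      refine ⟨x, hx, y, hy, hxy, ?_, h⟩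
      rintro rfl
      apply ha
      rw [← h, inner_neg_left, real_inner_self_eq_norm_sq, hX y hy]
      norm_num
    · rintro ⟨x, hx, y, hy, hxy, hxy', h⟩
      refine ⟨?_, x, hx, y, hy, hxy, h⟩
      rintro rfl
      exact hxy' (inner_neg_one (hX x hx) (hX y hy) h)
  have hAneg : ∀ a ∈ A, -a ∈ A := by
    intro a ha
    obtain ⟨x, hx, y, hy, hxy, hxy', h⟩ := (hAmem a).mp ha
    exact (hAmem _).mpr ⟨x, hx, -y, hanti y hy, hxy', by simpa using hxy, by
      rw [inner_neg_right, h]⟩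
  have hcard := card_sq_image A hAneg
  have hAcard : A.card + 1 = (innerSet m X).card := by
    rw [hA]
    apply Finset.card_erase_add_one
    obtain ⟨x, hx⟩ := hne
    rw [mem_innerSet]
    refine ⟨x, hx, -x, hanti x hx, hx0 x hx, ?_⟩
    rw [inner_neg_right, real_inner_self_eq_norm_sq, hX x hx]
    norm_num
  set r := (innerSet m X).card / 2 with hr
  have hBr : B.card ≤ r := by rw [← hB] at hcard; omega
  have hgood := evenGood_pow hm (evenGood_prod hm B) (r - B.card)
  rw [show B.card + (r - B.card) = r by omega] at hgood
  set F := (Polynomial.X ^ 2) ^ (r - B.card) * ∏ b ∈ B, (Polynomial.X ^ 2 - Polynomial.C b)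
    with hF
  have hFe : ∀ a : ℝ, F.eval a = (a ^ 2) ^ (r - B.card) * ∏ b ∈ B, (a ^ 2 - b) := by
    intro a
    simp [hF, Polynomial.eval_prod]
  obtain ⟨f, hfr, hf⟩ := hgood.expand
  refine ⟨F.eval 1, f, ?_, hfr, ?_⟩
  · rw [hFe]
    simp only [one_pow, one_mul]
    rw [Finset.prod_ne_zero_iff]
    intro b hb h
    obtain ⟨a, ha, rfl⟩ := Finset.mem_image.mp hb
    obtain ⟨x, hx, y, hy, hxy, hxy', h'⟩ := (hAmem a).mp ha
    have : a ^ 2 = 1 := by linarith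
    rcases mul_self_eq_one_iff.mp ((pow_two a).symm.trans this) with h1 | h1
    · rw [h1] at h'
      exact hxy (inner_ne_one (hX x hx) (hX y hy) h')
    · rw [h1] at h'
      exact hxy' (inner_neg_one (hX x hx) (hX y hy) h')
  · intro x hx y hy
    have e : ∑ k ∈ Finset.range (r + 1), f k * (geg m (2 * k)).eval ⟪x, y⟫ = F.eval ⟪x, y⟫ := by
      rw [hf, Polynomial.eval_finsetSum]
      simp
    rw [e]
    by_cases h1 : x = y
    · subst h1
      rw [if_pos rfl, if_neg (fun h => hx0 x hx h.symm), real_inner_self_eq_norm_sq, hX x hx]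
      simp
    · by_cases h2 : -x = y
      · subst h2
        rw [if_neg h1, if_pos rfl, inner_neg_right, real_inner_self_eq_norm_sq, hX x hx, hFe, hFe]
        simp
      · rw [if_neg h1, if_neg h2, hFe]
        have hmem : ⟪x, y⟫ ^ 2 ∈ B := Finset.mem_image.mpr ⟨_, (hAmem _).mpr
          ⟨x, hx, y, hy, h1, fun h => h2 (by rw [h, neg_neg]), rfl⟩, rfl⟩
        rw [Finset.prod_eq_zero hmem (sub_self _)]
        simp

theorem main_bound (hm : 2 ≤ m) (X : Finset (EuclideanSpace ℝ (Fin m)))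
    (hX : ∀ x ∈ X, ‖x‖ = 1) (hanti : ∀ x ∈ X, -x ∈ X) (hne : X.Nonempty) (r : ℕ)
    (hr : (innerSet m X).card / 2 = r) :
    X.card ≤ 2 * ∑ k ∈ Finset.range (r + 1), hdim m (2 * k) ∧
    ∀ j < r, (∀ l, 1 ≤ l → l < 2 * (j + r) → pairSum X (geg m l) = 0) →
      pairSum X (geg m (2 * (j + r))) ≠ 0 →
      X.card + 2 * hdim m (2 * j) ≤ 2 * ∑ k ∈ Finset.range (r + 1), hdim m (2 * k) := by
  obtain ⟨F1, f, hF1, hfr, hf⟩ := exists_annihilator hm X hX hanti hne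
  rw [hr] at hfr hf
  let σ : X → X := fun x => ⟨-x.1, hanti x.1 x.2⟩
  have hσ : ∀ x, σ (σ x) = x := fun x => Subtype.ext (neg_neg x.1)
  let P : Matrix X X ℝ := Matrix.of fun x y => if σ x = y then 1 else 0
  have hP : ∀ A : Matrix X X ℝ, P * A = Matrix.of fun x y => A (σ x) y := by
    intro A
    ext x y
    simp [P, Matrix.mul_apply]
  have hPP : P * P = 1 := by
    rw [hP]
    ext x y
    simp [P, hσ, Matrix.one_apply]
  have hPtr : P.trace = 0 := by
    simp only [Matrix.trace, Matrix.diag_apply]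
    refine Finset.sum_eq_zero fun x _ => ?_
    simp only [P, Matrix.of_apply]
    rw [if_neg]
    intro h
    have h0 : x.1 = 0 := eq_zero_of_eq_neg_self (congrArg Subtype.val h).symm
    have := hX x.1 x.2
    rw [h0, norm_zero] at this
    exact zero_ne_one this
  set J : Matrix X X ℝ := 1 + P with hJ
  have hJJ : J * J = (2:ℝ) • J := by
    rw [hJ, Matrix.add_mul, Matrix.mul_add, Matrix.mul_add, hPP, two_smul]
    simp only [Matrix.one_mul, Matrix.mul_one]
    abel
  have hJr := trace_le_rank J hJJ
  rw [hJ, Matrix.trace_add, Matrix.trace_one, hPtr, add_zero, Fintype.card_coe, ← hJ] at hJr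
  have hJr' : X.card = 2 * J.rank := by exact_mod_cast hJr
  have hsum : ∑ k ∈ Finset.range (r + 1), f k • gmat X (2 * k) = F1 • J := by
    ext x y
    have := hf x.1 x.2 y.1 y.2
    rw [Matrix.sum_apply]
    simp only [Matrix.smul_apply, gmat, Matrix.of_apply, smul_eq_mul]
    rw [this]
    simp only [hJ, Matrix.add_apply, Matrix.one_apply, P, Matrix.of_apply, σ, Subtype.ext_iff]
  have hJM : ∀ k, J * gmat X (2 * k) = (2:ℝ) • gmat X (2 * k) := by
    intro k
    have : P * gmat X (2 * k) = gmat X (2 * k) := by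
      rw [hP]
      ext x y
      simp only [gmat, Matrix.of_apply, σ]
      rw [inner_neg_left, geg_even]
    rw [hJ, Matrix.add_mul, this, Matrix.one_mul, two_smul]
  constructor
  · have := rank_core_a r (fun k => gmat X (2 * k)) (fun k => hdim m (2 * k))
      (fun k => gmat_rank hm X hX _) J F1 hF1 f hsum
    omega
  · intro j hj hdes hnot
    have hT : 2 * (j + r) - 1 + 1 = 2 * (j + r) := by omega
    have hS : ∀ l, 1 ≤ l → l ≤ 2 * (j + r) - 1 → pairSum X (geg m l) = 0 :=
      fun l h1 h2 => hdes l h1 (by omega)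
    have hcore := rank_core_b r j hj (fun k => gmat X (2 * k)) (fun k => hdim m (2 * k))
      (fun k => gmat_rank hm X hX _) J F1 hF1 f hfr hsum (hJM j) ?_ X.card ?_ ?_
    · beta_reduce at hcore
      omega
    · intro k hk hkj
      obtain ⟨d, H, _, hH⟩ := gmat_factor hm X hX (2 * k)
      obtain ⟨d', K, _, hK⟩ := gmat_factor hm X hX (2 * j)
      have ht : (gmat X (2 * k) * gmat X (2 * j)).trace = 0 := by
        rw [trace_gmat_mul]
        rcases lt_or_gt_of_ne hkj with h | h
        · exact S_prod_zero _ _ hm hS (by omega) (by omega)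
        · rw [mul_comm]
          exact S_prod_zero _ _ hm hS (by omega) (by omega)
      change gmat X (2 * k) * gmat X (2 * j) = 0
      rw [hH, hK] at ht ⊢
      exact gram_mul_zero H K ht
    · obtain ⟨d, H, hd, hH⟩ := gmat_factor hm X hX (2 * j)
      have t1 := trace_gmat hm X hX (2 * j)
      have t2 := trace_gmat_mul X (2 * j) (2 * j)
      rw [S_sq _ _ hm hS (2 * j) (by omega), geg_one hm, pairSum_apply] at t2
      have t3 : (gmat X (2 * j) * gmat X (2 * j)).trace = (X.card : ℝ) ^ 2 * hdim m (2 * j) := by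
        rw [t2]
        simp only [Polynomial.eval_one, Finset.sum_const, nsmul_eq_mul, mul_one]
        ring
      change gmat X (2 * j) * gmat X (2 * j) = _ • gmat X (2 * j)
      rw [hH] at t1 t3 ⊢
      exact gram_sq hd H _ t1 t3
    · change gmat X (2 * r) * gmat X (2 * j) ≠ 0
      intro h0
      have h1 := trace_gmat_mul X (2 * r) (2 * j)
      rw [h0, Matrix.trace_zero, mul_comm] at h1
      exact S_prod_ne _ _ hm hS (a := 2 * j) (b := 2 * r) (by omega) (by omega)
        (by rw [hT]; exact hnot) h1.symm

end Main

/-- Let `X ⊆ S^{m-1}` be an antipodal `s`-distance set with strength `2s - 2i - 1`,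
where `1 + δ_s ≤ i ≤ s + δ_s` and `δ_s = s mod 2`.  Then
`|X| ≤ 2 ∑_{k=0}^{(s-δ_s)/2} h_{2k} - 2 h_{s+δ_s-2i}`. -/
theorem card_antipodal_distance_set_strength (m s i : ℕ)
    (hi1 : 1 + s % 2 ≤ i) (hi2 : i ≤ s + s % 2)
    (X : Finset (EuclideanSpace ℝ (Fin m))) (hX : ∀ x ∈ X, ‖x‖ = 1)
    (hanti : ∀ x ∈ X, -x ∈ X)
    (hdist : (innerSet m X).card = s)
    (hdes : IsGegDesignZ m (2 * (s : ℤ) - 2 * i - 1) X)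
    (hnot : ¬ IsGegDesignZ m (2 * (s : ℤ) - 2 * i) X) :
    X.card ≤ 2 * (∑ k ∈ Finset.range ((s - s % 2) / 2 + 1), hdim m (2 * k)) -
      2 * hdimZ m ((s : ℤ) + s % 2 - 2 * i) := by
  have hpos : 1 ≤ s := by omega
  have hlt : i < s := by
    by_contra hge
    apply hnot
    intro l h1 h2
    omega
  have hneA : (innerSet m X).Nonempty := by
    rw [← Finset.card_pos]; omega
  have hne : X.Nonempty := by
    obtain ⟨a, ha⟩ := hneA
    obtain ⟨x, hx, _⟩ := mem_innerSet.mp ha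
    exact ⟨x, hx⟩
  have hm : 2 ≤ m := by
    by_contra hm
    have hsub : innerSet m X ⊆ {-1} := by
      intro a ha
      obtain ⟨x, hx, y, hy, hxy, h⟩ := mem_innerSet.mp ha
      have hx1 := hX x hx
      have hy1 := hX y hy
      rw [Finset.mem_singleton]
      obtain rfl | rfl : m = 0 ∨ m = 1 := by omega
      · exact absurd (Subsingleton.elim x y) hxy
      · have ex : x 0 ^ 2 = 1 := by
          have := real_inner_self_eq_norm_sq x
          rw [hx1, PiLp.inner_apply] at this
          simpa [← pow_two] using this
        have ey : y 0 ^ 2 = 1 := by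
          have := real_inner_self_eq_norm_sq y
          rw [hy1, PiLp.inner_apply] at this
          simpa [← pow_two] using this
        have e : a = x 0 * y 0 := by
          rw [← h, PiLp.inner_apply]
          simp [mul_comm]
        have e2 : a ^ 2 = 1 := by rw [e, mul_pow, ex, ey, one_mul]
        rcases mul_self_eq_one_iff.mp ((pow_two a).symm.trans e2) with h1 | h1
        · rw [h1] at h
          exact absurd (inner_ne_one hx1 hy1 h) hxy
        · exact h1
    have := Finset.card_le_card hsub
    rw [hdist, Finset.card_singleton] at this
    have hs : s = 1 := by omega
    subst hs
    omega
  have hr : (s - s % 2) / 2 = s / 2 := by omega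
  rw [hr]
  obtain ⟨hA, hB⟩ := main_bound hm X hX hanti hne (s / 2) (by rw [hdist])
  unfold hdimZ
  split_ifs with hneg
  · simpa using hA
  · obtain ⟨j, hj⟩ : ∃ j : ℕ, ((s : ℤ) + (s % 2 : ℕ) - 2 * i) = 2 * j :=
      ⟨s / 2 + s % 2 - i, by push_cast at hneg ⊢; omega⟩
    have hj' : ((s : ℤ) + s % 2 - 2 * i).toNat = 2 * j := by push_cast at hj; omega
    rw [hj']
    have hjr : j < s / 2 := by omega
    have hjt : 2 * (j + s / 2) = 2 * s - 2 * i := by omega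
    have hz : ∀ l, 1 ≤ l → l < 2 * (j + s / 2) → pairSum X (geg m l) = 0 := by
      intro l h1 h2
      rw [pairSum_apply]
      have := hdes l (by omega) (by omega)
      simpa using this
    have := hB j hjr hz ?_
    · omega
    · intro h0
      apply hnot
      intro l h1 h2
      by_cases hl : l ≤ 2 * (s : ℤ) - 2 * i - 1
      · exact hdes l h1 hl
      · have : l.toNat = 2 * (j + s / 2) := by omega
        rw [this, ← pairSum_apply, h0]
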